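/- arXiv:1609.04140 — 6 statements merged into one kernel-verified Lean document; each statement's English description precedes it below -/
import Mathlib

section
/- Let N ≥ 1 be an integer and let x, y be integers with x − y odd. Then ∑_{s₁=0}^{2N−1} ∑_{s₂=0}^{2N−1} e((s₁(x+y) + s₂(y−x))/(2N))·B̄₁(s₁/(2N))·B̄₁(s₂/(2N)) = −(1/4)·(cos(πx/N) + cos(πy/N))/(cos(πx/N) − cos(πy/N)). (Since x + y and x − y are odd, cos(πx/N) − cos(πy/N) = 2·sin(π(x+y)/(2N))·sin(π(x−y)/(2N)) ≠ 0, so the right-hand side is defined.) -/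
/-- The periodic first Bernoulli (sawtooth) function: `B1 x = x - ⌊x⌋ - 1/2` for
`x ∉ ℤ`, and `B1 x = 0` for `x ∈ ℤ`. -/
noncomputable def B1 (x : ℝ) : ℝ := if Int.fract x = 0 then 0 else Int.fract x - 1/2

/-- `e x = exp (2πix)`. -/
noncomputable def e (x : ℝ) : ℂ := Complex.exp (2 * Real.pi * Complex.I * x)

theorem aux_sum (z : ℂ) (n : ℕ) : (z - 1)^2 * ∑ s ∈ Finset.range n, (s : ℂ) * z^s
    = n * z^n * (z - 1) - z * (z^n - 1) := by
  induction n with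
  | zero => simp
  | succ n ih =>
    rw [Finset.sum_range_succ, mul_add, ih]
    push_cast
    ring

theorem aux_B1 (M s : ℕ) (hs : s < M) :
    B1 ((s : ℝ) / M) = (s : ℝ) / M - 1/2 + if s = 0 then 1/2 else 0 := by
  have hM : (0 : ℝ) < M := by exact_mod_cast (by omega : 0 < M)
  have hf : Int.fract ((s : ℝ) / M) = (s : ℝ) / M := by
    rw [Int.fract_eq_self]
    refine ⟨by positivity, ?_⟩
    rw [div_lt_one hM]
    exact_mod_cast hs
  unfold B1
  rw [hf]
  by_cases h : s = 0
  · simp [h]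
  · have : (s : ℝ) / M ≠ 0 := div_ne_zero (by exact_mod_cast h) hM.ne'
    simp [h, this]

theorem aux_T (M : ℕ) (hM : 0 < M) (z : ℂ) (hz : z^M = 1) (h1 : z ≠ 1) :
    ∑ s ∈ Finset.range M, z^s * (B1 ((s : ℝ) / M) : ℂ) = (z + 1) / (2 * (z - 1)) := by
  have h1' : z - 1 ≠ 0 := sub_ne_zero.mpr h1
  have hMc : (M : ℂ) ≠ 0 := by exact_mod_cast hM.ne'
  have hs := aux_sum z M
  have hg := mul_geom_sum z M
  rw [hz] at hs hg
  have hg' : ∑ s ∈ Finset.range M, z^s = 0 := by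
    rw [sub_self] at hg
    exact (mul_eq_zero.mp hg).resolve_left h1'
  have hs' : ∑ s ∈ Finset.range M, (s : ℂ) * z^s = M / (z - 1) := by
    rw [eq_div_iff h1']
    apply mul_left_cancel₀ h1'
    linear_combination hs
  have : ∀ s ∈ Finset.range M, z^s * (B1 ((s : ℝ) / M) : ℂ)
      = (1 / M : ℂ) * ((s : ℂ) * z^s) - 1/2 * z^s + if s = 0 then 1/2 else 0 := by
    intro s hs
    rw [aux_B1 M s (Finset.mem_range.mp hs)]
    by_cases h : s = 0
    · simp [h]
    · simp [h]; ring
  rw [Finset.sum_congr rfl this, Finset.sum_add_distrib, Finset.sum_sub_distrib,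
    ← Finset.mul_sum, ← Finset.mul_sum, hs', hg', Finset.sum_ite_eq' ]
  simp only [Finset.mem_range, hM, if_true]
  field_simp
  ring

theorem aux_U (N : ℕ) (hN : 1 ≤ N) (a : ℤ) (ha : Odd a) :
    Real.sin (Real.pi * a / (2 * N)) ≠ 0 ∧
    ∑ s ∈ Finset.range (2 * N), e ((s : ℝ) * a / (2 * N)) * (B1 ((s : ℝ) / (2 * N)) : ℂ)
      = Real.cos (Real.pi * a / (2 * N)) / (2 * Complex.I * Real.sin (Real.pi * a / (2 * N))) := by
  have hNr : (N : ℝ) ≠ 0 := by exact_mod_cast (by omega : N ≠ 0)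
  have hNc : (N : ℂ) ≠ 0 := by exact_mod_cast (by omega : N ≠ 0)
  have hsin : Real.sin (Real.pi * a / (2 * N)) ≠ 0 := by
    intro h
    obtain ⟨k, hk⟩ := Real.sin_eq_zero_iff.mp h
    have hp := Real.pi_ne_zero
    field_simp at hk
    have : a = 2 * (k * N) := by
      have h2 : (a : ℝ) = ((2 * (k * N) : ℤ) : ℝ) := by push_cast; linarith
      exact_mod_cast h2
    rw [this] at ha
    exact (Int.not_odd_iff_even.mpr (even_two_mul _)) ha
  refine ⟨hsin, ?_⟩
  set A : ℝ := Real.pi * a / (2 * N) with hA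
  set w : ℂ := Complex.exp (A * Complex.I) with hw
  have hw0 : w ≠ 0 := Complex.exp_ne_zero _
  have hwe : w = Real.cos A + Real.sin A * Complex.I := by
    rw [hw, Complex.exp_mul_I]; simp
  have hcs : (Real.cos A : ℂ)^2 + (Real.sin A : ℂ)^2 = 1 := by
    exact_mod_cast Real.cos_sq_add_sin_sq A
  have hI := Complex.I_sq
  have hp : w^2 + 1 = 2 * w * Real.cos A := by
    rw [hwe]; linear_combination (Real.sin A : ℂ)^2 * hI - hcs
  have hm : w^2 - 1 = 2 * Complex.I * w * Real.sin A := by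
    rw [hwe]; linear_combination -(Real.sin A : ℂ)^2 * hI + hcs
  have hsc : (Real.sin A : ℂ) ≠ 0 := by exact_mod_cast hsin
  have h1 : w^2 ≠ 1 := by
    rw [← sub_ne_zero, hm]
    exact mul_ne_zero (mul_ne_zero (mul_ne_zero two_ne_zero Complex.I_ne_zero) hw0) hsc
  have hz : (w^2)^(2*N) = 1 := by
    rw [← pow_mul, hw, ← Complex.exp_nat_mul, Complex.exp_eq_one_iff]
    refine ⟨a, ?_⟩
    rw [hA]; push_cast; field_simp
  have hT := aux_T (2*N) (by omega) (w^2) hz h1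
  have he : ∀ s : ℕ, e ((s : ℝ) * a / (2 * N)) = (w^2)^s := by
    intro s
    unfold e
    rw [← pow_mul, hw, ← Complex.exp_nat_mul]
    congr 1
    rw [hA]; push_cast; field_simp
  simp only [he]
  push_cast at hT
  rw [hT, hp, hm]
  have hI0 := Complex.I_ne_zero
  field_simp

theorem stmt2 (N : ℕ) (hN : 1 ≤ N) (x y : ℤ) (hxy : Odd (x - y)) :
    ∑ s₁ ∈ Finset.range (2 * N), ∑ s₂ ∈ Finset.range (2 * N),
      e (((s₁ : ℝ) * ((x : ℝ) + (y : ℝ)) + (s₂ : ℝ) * ((y : ℝ) - (x : ℝ))) / (2 * N)) *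
        (B1 ((s₁ : ℝ) / (2 * N)) : ℂ) * (B1 ((s₂ : ℝ) / (2 * N)) : ℂ)
    = -(1/4 : ℂ) *
        ((Real.cos (Real.pi * (x : ℝ) / N) + Real.cos (Real.pi * (y : ℝ) / N)) /
          (Real.cos (Real.pi * (x : ℝ) / N) - Real.cos (Real.pi * (y : ℝ) / N)) : ℝ) := by
  have hNr : (N : ℝ) ≠ 0 := by exact_mod_cast (by omega : N ≠ 0)
  obtain ⟨s1, h1⟩ := aux_U N hN (x + y) (by grind)
  obtain ⟨s2, h2⟩ := aux_U N hN (y - x) (by grind)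
  push_cast at s1 s2
  have hsum : ∀ s₁ s₂ : ℕ,
      e (((s₁ : ℝ) * ((x : ℝ) + (y : ℝ)) + (s₂ : ℝ) * ((y : ℝ) - (x : ℝ))) / (2 * N)) *
        (B1 ((s₁ : ℝ) / (2 * N)) : ℂ) * (B1 ((s₂ : ℝ) / (2 * N)) : ℂ)
      = (e ((s₁ : ℝ) * ((x + y : ℤ) : ℝ) / (2 * N)) * (B1 ((s₁ : ℝ) / (2 * N)) : ℂ)) *
        (e ((s₂ : ℝ) * ((y - x : ℤ) : ℝ) / (2 * N)) * (B1 ((s₂ : ℝ) / (2 * N)) : ℂ)) := by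
    intro s₁ s₂
    have : e (((s₁ : ℝ) * ((x : ℝ) + (y : ℝ)) + (s₂ : ℝ) * ((y : ℝ) - (x : ℝ))) / (2 * N))
        = e ((s₁ : ℝ) * ((x + y : ℤ) : ℝ) / (2 * N)) *
          e ((s₂ : ℝ) * ((y - x : ℤ) : ℝ) / (2 * N)) := by
      unfold e
      rw [← Complex.exp_add]
      congr 1
      push_cast
      ring
    rw [this]; ring
  simp only [hsum]
  rw [← Finset.sum_mul_sum, h1, h2]
  simp only [Int.cast_add, Int.cast_sub]
  set A : ℝ := Real.pi * ((x : ℝ) + y) / (2 * N) with hA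
  set B : ℝ := Real.pi * ((y : ℝ) - x) / (2 * N) with hB
  have hx : Real.pi * (x : ℝ) / N = A - B := by rw [hA, hB]; field_simp; ring
  have hy : Real.pi * (y : ℝ) / N = A + B := by rw [hA, hB]; field_simp; ring
  rw [hx, hy]
  have hr : (Real.cos (A - B) + Real.cos (A + B)) / (Real.cos (A - B) - Real.cos (A + B))
      = (Real.cos A * Real.cos B) / (Real.sin A * Real.sin B) := by
    rw [Real.cos_sub, Real.cos_add,
      show ∀ p q : ℝ, (p + q + (p - q)) = 2 * p by intros; ring,
      show ∀ p q : ℝ, (p + q - (p - q)) = 2 * q by intros; ring,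
      mul_div_mul_left _ _ two_ne_zero]
  rw [hr]
  have s1c : (Real.sin A : ℂ) ≠ 0 := by exact_mod_cast s1
  have s2c : (Real.sin B : ℂ) ≠ 0 := by exact_mod_cast s2
  rw [Complex.ofReal_div, Complex.ofReal_mul, Complex.ofReal_mul, div_mul_div_comm,
    show (2 * Complex.I * (Real.sin A : ℂ)) * (2 * Complex.I * (Real.sin B : ℂ))
      = -4 * ((Real.sin A : ℂ) * (Real.sin B : ℂ)) by
        linear_combination 4 * (Real.sin A : ℂ) * (Real.sin B : ℂ) * Complex.I_sq]
  field_simp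
end

section
/- Let N be an odd positive integer. Let x, y, x′, y′ be integers with x ≡ x′ (mod N), y ≡ y′ (mod N), and with both x − y and x′ − y′ odd. Then (cos(πx/N) + cos(πy/N))/(cos(πx/N) − cos(πy/N)) = (cos(πx′/N) + cos(πy′/N))/(cos(πx′/N) − cos(πy′/N)). (Both denominators are nonzero because x ± y and x′ ± y′ are odd.) Consequently, for N odd the function F(P) = −(1/4)·(cos(πx/N)+cos(πy/N))/(cos(πx/N)−cos(πy/N)), computed from any representative (x, y) of P ∈ (ℤ/Nℤ)² with x − y odd, is well defined. -/
theorem stmt3 (N : ℕ) (hN : Odd N) (hNpos : 0 < N) (x y x' y' : ℤ)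
    (hx : (N : ℤ) ∣ (x - x')) (hy : (N : ℤ) ∣ (y - y'))
    (hxy : Odd (x - y)) (hxy' : Odd (x' - y')) :
    (Real.cos (Real.pi * (x : ℝ) / N) + Real.cos (Real.pi * (y : ℝ) / N)) /
      (Real.cos (Real.pi * (x : ℝ) / N) - Real.cos (Real.pi * (y : ℝ) / N))
    = (Real.cos (Real.pi * (x' : ℝ) / N) + Real.cos (Real.pi * (y' : ℝ) / N)) /
      (Real.cos (Real.pi * (x' : ℝ) / N) - Real.cos (Real.pi * (y' : ℝ) / N)) := by
  obtain ⟨a, ha⟩ := hx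
  obtain ⟨b, hb⟩ := hy
  have hN0 : (N : ℝ) ≠ 0 := by positivity
  have hNz : Odd (N : ℤ) := by exact_mod_cast hN
  have key : ∀ u v c : ℤ, u - v = (N : ℤ) * c →
      Real.cos (Real.pi * (u : ℝ) / N) = (-1) ^ c * Real.cos (Real.pi * (v : ℝ) / N) := by
    intro u v c h
    have hu : (u : ℝ) = v + N * c := by
      have h2 : u = v + N * c := by linarith
      exact_mod_cast h2
    rw [← Real.cos_add_int_mul_pi, hu]
    congr 1
    field_simp
  have hab : Even (a - b) := by
    have h1 : Even ((N : ℤ) * (a - b)) := by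
      have h2 : (N : ℤ) * (a - b) = (x - y) - (x' - y') := by linarith
      rw [h2]
      exact hxy.sub_odd hxy'
    rcases Int.even_mul.mp h1 with h | h
    · exact absurd h (Int.not_even_iff_odd.mpr hNz)
    · exact h
  have hs : ((-1 : ℝ)) ^ a = (-1) ^ b := by
    have h3 : a = b + (a - b) := by ring
    rw [h3, zpow_add₀ (by norm_num), hab.neg_one_zpow, mul_one]
  have hb0 : ((-1 : ℝ)) ^ b ≠ 0 := zpow_ne_zero _ (by norm_num)
  rw [key x x' a ha, key y y' b hb, hs, ← mul_add, ← mul_sub, mul_div_mul_left _ _ hb0]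
end

section
/- Let d ≥ 1 be an integer and let β ∈ ℂ be a primitive 2d-th root of unity. Define f(x) = ∑_{k=0}^{2d−1} β^k·B̄₁(x + k/(2d)) for x ∈ ℝ. Then for every integer l with 0 ≤ l < 2d and every real x with l/(2d) < x < (l+1)/(2d), f(x) = β^{−l}/(β − 1). -/
theorem aux_lin (β : ℂ) (m : ℕ) : (β - 1) * ∑ k ∈ Finset.range m, β ^ k * (k : ℂ)
    = m * β ^ m - β * ∑ k ∈ Finset.range m, β ^ k := by
  induction m with
  | zero => simp
  | succ m ih =>
    rw [Finset.sum_range_succ, Finset.sum_range_succ, mul_add, ih]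
    push_cast
    ring

theorem aux_ind (β : ℂ) (p m : ℕ) :
    (β - 1) * ∑ k ∈ Finset.range m, β ^ k * (if p ≤ k then (1 : ℂ) else 0)
    = if p ≤ m then β ^ m - β ^ p else 0 := by
  induction m with
  | zero =>
    by_cases h : p = 0 <;> simp [h]
  | succ m ih =>
    rw [Finset.sum_range_succ, mul_add, ih]
    by_cases h : p ≤ m
    · have h' : p ≤ m + 1 := by omega
      simp only [h, h', if_true]
      ring
    · by_cases h' : p = m + 1
      · subst h'
        simp
      · have h2 : ¬ p ≤ m + 1 := by omega
        simp [h, h2]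

theorem aux_B1_s8 (y : ℝ) (z : ℤ) (h1 : (z : ℝ) < y) (h2 : y < z + 1) : B1 y = y - z - 1 / 2 := by
  have hf : ⌊y⌋ = z := Int.floor_eq_iff.mpr ⟨h1.le, h2⟩
  have hr : Int.fract y = y - z := by rw [← hf]; rfl
  unfold B1
  rw [hr, if_neg (by linarith)]

theorem stmt8 (d : ℕ) (hd : 1 ≤ d) (β : ℂ) (hβ : IsPrimitiveRoot β (2 * d))
    (l : ℕ) (hl : l < 2 * d) (x : ℝ)
    (hx1 : (l : ℝ) / (2 * d) < x) (hx2 : x < ((l : ℝ) + 1) / (2 * d)) :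
    ∑ k ∈ Finset.range (2 * d), β ^ k * (B1 (x + (k : ℝ) / (2 * d)) : ℂ)
      = β ^ (-(l : ℤ)) / (β - 1) := by
  have hn : (0 : ℝ) < 2 * d := by
    have : (1 : ℝ) ≤ d := by exact_mod_cast hd
    linarith
  have hβ1 : β ≠ 1 := hβ.ne_one (by omega)
  have hb : β - 1 ≠ 0 := sub_ne_zero.mpr hβ1
  have hβ0 : β ≠ 0 := hβ.ne_zero (by omega)
  have hgeom : ∑ k ∈ Finset.range (2 * d), β ^ k = 0 := hβ.geom_sum_eq_zero (by omega)
  rw [div_lt_iff₀ hn] at hx1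
  rw [lt_div_iff₀ hn] at hx2
  have key : ∀ k ∈ Finset.range (2 * d), β ^ k * (B1 (x + (k : ℝ) / (2 * d)) : ℂ)
      = β ^ k * ((x : ℂ) - 1 / 2) + (β ^ k * (k : ℂ)) * (1 / (2 * d))
        - β ^ k * (if 2 * d - l ≤ k then (1 : ℂ) else 0) := by
    intro k hk
    rw [Finset.mem_range] at hk
    have hm : (x + (k : ℝ) / (2 * d)) * (2 * d) = x * (2 * d) + k := by
      field_simp
    by_cases h : 2 * d - l ≤ k
    · have h3 : (2 * d : ℝ) ≤ k + l := by
        have : 2 * d ≤ k + l := by omega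
        exact_mod_cast this
      have h4 : (k + l + 1 : ℝ) ≤ 2 * (2 * d) := by
        have : k + l + 1 ≤ 2 * (2 * d) := by omega
        exact_mod_cast this
      rw [aux_B1_s8 _ 1 (lt_of_mul_lt_mul_right (a := 2 * (d : ℝ)) (by rw [hm]; push_cast; linarith) hn.le)
        (lt_of_mul_lt_mul_right (a := 2 * (d : ℝ)) (by rw [hm]; push_cast; linarith) hn.le), if_pos h]
      push_cast
      ring
    · have h3 : (k + l + 1 : ℝ) ≤ 2 * d := by
        have : k + l + 1 ≤ 2 * d := by omega
        exact_mod_cast this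
      have h4 : (0 : ℝ) ≤ k + l := by positivity
      rw [aux_B1_s8 _ 0 (lt_of_mul_lt_mul_right (a := 2 * (d : ℝ)) (by rw [hm]; push_cast; linarith) hn.le)
        (lt_of_mul_lt_mul_right (a := 2 * (d : ℝ)) (by rw [hm]; push_cast; linarith) hn.le), if_neg h]
      push_cast
      ring
  rw [Finset.sum_congr rfl key, Finset.sum_sub_distrib, Finset.sum_add_distrib,
    ← Finset.sum_mul, ← Finset.sum_mul, hgeom, eq_div_iff hb]
  have e1 := aux_lin β (2 * d)
  have e2 := aux_ind β (2 * d - l) (2 * d)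
  rw [hgeom, hβ.pow_eq_one] at e1
  rw [if_pos (Nat.sub_le _ _), hβ.pow_eq_one] at e2
  have e3 : β ^ (2 * d - l) = β ^ (-(l : ℤ)) := by
    rw [zpow_neg, zpow_natCast, pow_sub₀ _ hβ0 hl.le, hβ.pow_eq_one, one_mul]
  rw [e3] at e2
  have hnc : (2 * d : ℂ) ≠ 0 := by exact_mod_cast hn.ne'
  push_cast at e1
  have e4 : (2 * d : ℂ) * (1 / (2 * d)) = 1 := mul_one_div_cancel hnc
  linear_combination (1 / (2 * d : ℂ)) * e1 - e2 + e4
end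

section
/- Let d ≥ 1 be an integer and let β ∈ ℂ be a primitive 2d-th root of unity. Define f(x) = ∑_{k=0}^{2d−1} β^k·B̄₁(x + k/(2d)) for x ∈ ℝ. Then for every integer l with 0 ≤ l < 2d, f(l/(2d)) = β^{−l}(1 + β)/(2(β − 1)). -/
lemma sum_k_pow (β : ℂ) (m : ℕ) :
    (β - 1) * ∑ k ∈ Finset.range m, (k : ℂ) * β ^ k
      = m * β ^ m - β * ∑ k ∈ Finset.range m, β ^ k := by
  induction m with
  | zero => simp
  | succ m ih =>
    rw [Finset.sum_range_succ, Finset.sum_range_succ, mul_add, ih]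
    push_cast
    ring

lemma sum_shift (g : ℕ → ℂ) (n : ℕ) (hg : ∀ k, g (k + n) = g k) (l : ℕ) :
    ∑ k ∈ Finset.range n, g (k + l) = ∑ k ∈ Finset.range n, g k := by
  induction l with
  | zero => simp
  | succ l ih =>
    rw [← ih]
    have h1 := Finset.sum_range_succ (fun k => g (k + l)) n
    have h2 := Finset.sum_range_succ' (fun k => g (k + l)) n
    have h3 := hg l
    have h4 : ∑ k ∈ Finset.range n, g (k + (l + 1)) = ∑ k ∈ Finset.range n, g (k + 1 + l) :=
      Finset.sum_congr rfl fun k _ => by congr 1; ring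
    rw [h4]
    rw [h1] at h2
    simp only [zero_add] at h2
    rw [add_comm n l, h3] at h2
    exact (add_right_cancel h2).symm

lemma B1_small (n k : ℕ) (hk : k < n) :
    (B1 ((k : ℝ) / n) : ℂ) = (k : ℂ) / n - 1 / 2 + if k = 0 then 1 / 2 else 0 := by
  have hn : (0 : ℝ) < n := by exact_mod_cast (by omega : 0 < n)
  have hf : Int.fract ((k : ℝ) / n) = (k : ℝ) / n := by
    rw [Int.fract_eq_self]
    exact ⟨by positivity, by rw [div_lt_one hn]; exact_mod_cast hk⟩
  unfold B1
  rw [hf]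
  rcases Nat.eq_zero_or_pos k with h | h
  · simp [h]
  · have : (k : ℝ) / n ≠ 0 := by positivity
    rw [if_neg this, if_neg (by omega)]
    push_cast
    ring

theorem stmt9 (d : ℕ) (hd : 1 ≤ d) (β : ℂ) (hβ : IsPrimitiveRoot β (2 * d))
    (l : ℕ) (hl : l < 2 * d) :
    ∑ k ∈ Finset.range (2 * d), β ^ k * (B1 ((l : ℝ) / (2 * d) + (k : ℝ) / (2 * d)) : ℂ)
      = β ^ (-(l : ℤ)) * (1 + β) / (2 * (β - 1)) := by
  obtain ⟨n, hn⟩ : ∃ n, n = 2 * d := ⟨_, rfl⟩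
  have hc : (2 * d : ℝ) = (n : ℝ) := by rw [hn]; push_cast; ring
  rw [hc]
  rw [← hn] at hβ hl ⊢
  have hn2 : 1 < n := by omega
  have hnC : (n : ℂ) ≠ 0 := by exact_mod_cast (by omega : n ≠ 0)
  have hnR : (n : ℝ) ≠ 0 := by exact_mod_cast (by omega : n ≠ 0)
  have h0 : β ≠ 0 := hβ.ne_zero (by omega)
  have h1 : β - 1 ≠ 0 := sub_ne_zero.mpr (hβ.ne_one hn2)
  have hG := hβ.geom_sum_eq_zero hn2
  have hS := sum_k_pow β n
  rw [hG, hβ.pow_eq_one] at hS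
  have hs := sum_shift (fun k => β ^ k * (B1 ((k : ℝ) / n) : ℂ)) n (by
    intro k
    have : ((k + n : ℕ) : ℝ) / n = (k : ℝ) / n + 1 := by
      push_cast; field_simp
    simp only [this, pow_add, hβ.pow_eq_one, B1, Int.fract_add_one, mul_one]) l
  have hb : ∑ k ∈ Finset.range n, β ^ k * (B1 ((k : ℝ) / n) : ℂ)
      = (∑ k ∈ Finset.range n, (k : ℂ) * β ^ k) / n
        - (∑ k ∈ Finset.range n, β ^ k) / 2 + 1 / 2 := by
    have : (1 / 2 : ℂ) = ∑ k ∈ Finset.range n, if k = 0 then 1 / 2 else 0 := by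
      rw [Finset.sum_ite_eq' (Finset.range n) 0, if_pos (by simp; omega)]
    rw [this, Finset.sum_div, Finset.sum_div, ← Finset.sum_sub_distrib, ← Finset.sum_add_distrib]
    refine Finset.sum_congr rfl fun k hk => ?_
    rw [B1_small n k (Finset.mem_range.mp hk)]
    split_ifs with h
    · subst h; simp
    · ring
  have hl' : ∑ k ∈ Finset.range n, β ^ (k + l) * (B1 (((k + l : ℕ) : ℝ) / n) : ℂ)
      = β ^ l * ∑ k ∈ Finset.range n, β ^ k * (B1 ((l : ℝ) / n + (k : ℝ) / n) : ℂ) := by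
    rw [Finset.mul_sum]
    refine Finset.sum_congr rfl fun k _ => ?_
    have : ((k + l : ℕ) : ℝ) / n = (l : ℝ) / n + (k : ℝ) / n := by push_cast; ring
    rw [this]; ring
  have hS' : ∑ k ∈ Finset.range n, (k : ℂ) * β ^ k = n / (β - 1) := by
    rw [eq_div_iff h1]; linear_combination hS
  rw [hl', hb, hG, hS'] at hs
  have hp : β ^ l ≠ 0 := pow_ne_zero _ h0
  apply mul_left_cancel₀ hp
  rw [hs, zpow_neg, zpow_natCast]
  field_simp
  ring
end

section
/- Let N be an odd positive integer and let χ be an even Dirichlet character modulo N (i.e., χ(−1) = 1). Let χ₂ be the Dirichlet character modulo 2N induced by χ, i.e., χ₂(n) = χ(n mod N) for n coprime to 2N and χ₂(n) = 0 otherwise; since N is odd this means χ₂(n) = χ(n) for odd n and χ₂(n) = 0 for even n. Then (1/2)·∑_{μ ∈ (ℤ/Nℤ)ˣ} χ(μ)/(1 − cos(πμ⁰/N)) = (2N²/π²)·∑_{n=1}^{∞} χ₂(n)/n², where for each μ, μ⁰ ∈ ℤ is any odd integer representative of μ modulo N (the summand is independent of this choice, and 1 − cos(πμ⁰/N) ≠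 0 since μ⁰ is odd). -/
open Filter Topology UpperHalfPlane

lemma hz_deriv (z : ℂ) (hz : 0 < z.im) :
    ∑' n : ℤ, 1 / (z + n) ^ 2 = Real.pi ^ 2 / (Complex.sin (Real.pi * z)) ^ 2 := by
  have h := iteratedDerivWithin_cot_pi_mul_eq_mul_tsum_div_pow (k := 1) le_rfl (z := z) hz
  have hs : Complex.sin (Real.pi * z) ≠ 0 :=
    sin_pi_mul_ne_zero (UpperHalfPlane.coe_mem_integerComplement ⟨z, hz⟩)
  rw [iteratedDerivWithin_of_isOpen UpperHalfPlane.isOpen_upperHalfPlaneSet hz, iteratedDeriv_one] at h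
  have hd : HasDerivAt (fun x : ℂ ↦ (Real.pi : ℂ) * Complex.cot (Real.pi * x))
      (Real.pi * ((-Complex.sin (Real.pi * z) * (Real.pi * 1) * Complex.sin (Real.pi * z)
        - Complex.cos (Real.pi * z) * (Complex.cos (Real.pi * z) * (Real.pi * 1)))
        / (Complex.sin (Real.pi * z)) ^ 2)) z := by
    have hl : HasDerivAt (fun x : ℂ ↦ (Real.pi : ℂ) * x) (Real.pi * 1) z :=
      (hasDerivAt_id z).const_mul _
    exact ((hl.ccos.div hl.csin hs).const_mul _)
  rw [hd.deriv] at h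
  have h2 := Complex.sin_sq_add_cos_sq (Real.pi * z)
  simp only [pow_one, Nat.factorial_one, Nat.cast_one, mul_one] at h
  norm_num at h
  norm_num
  have h3 : ∑' n : ℤ, ((z + n) ^ 2)⁻¹ = - (- ∑' n : ℤ, ((z + n) ^ 2)⁻¹) := by ring
  rw [h3, ← h]
  field_simp
  linear_combination h2

lemma real_sum (x : ℝ) (hx : Real.sin (Real.pi * x) ≠ 0) :
    ∑' n : ℤ, 1 / ((x : ℂ) + n) ^ 2 = Real.pi ^ 2 / (Complex.sin (Real.pi * x)) ^ 2 := by
  have hs : Complex.sin (Real.pi * x) ≠ 0 := by exact_mod_cast hx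
  have hne : ∀ n : ℤ, x + n ≠ 0 := by
    intro n h
    apply hx
    rw [show x = ((-n : ℤ) : ℝ) by push_cast; linarith, mul_comm]
    exact Real.sin_int_mul_pi _
  have t1 : Tendsto (fun t : ℝ ↦ ∑' n : ℤ, 1 / (((x : ℂ) + t * Complex.I) + n) ^ 2) (𝓝[>] 0)
      (𝓝 (∑' n : ℤ, 1 / ((x : ℂ) + n) ^ 2)) := by
    refine tendsto_tsum_of_dominated_convergence (bound := fun n : ℤ ↦ ‖1 / ((x : ℂ) + n) ^ 2‖) ?_ ?_ ?_
    · have := (EisensteinSeries.linear_right_summable (x:ℂ) 1 (k := 2) (by norm_num)).norm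
      refine this.congr fun n ↦ ?_
      simp
    · intro n
      have hn : (x : ℂ) + n ≠ 0 := by exact_mod_cast hne n
      have : ContinuousAt (fun t : ℝ ↦ 1 / (((x : ℂ) + t * Complex.I) + n) ^ 2) 0 := by
        refine ContinuousAt.div (by fun_prop) (by fun_prop) ?_
        simpa using hn
      have := this.tendsto
      simp only [Complex.ofReal_zero, zero_mul, add_zero] at this
      exact this.mono_left nhdsWithin_le_nhds
    · refine Eventually.of_forall fun t n ↦ ?_
      have hn : (x : ℂ) + n ≠ 0 := by exact_mod_cast hne n
      simp only [norm_div, norm_pow, norm_one]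
      have := norm_pos_iff.2 hn
      gcongr
      rw [show (x : ℂ) + n = (((x + n : ℝ)) : ℂ) by push_cast; rfl, Complex.norm_real]
      have := Complex.abs_re_le_norm ((x : ℂ) + t * Complex.I + n)
      simpa using this
  have t2 : Tendsto (fun t : ℝ ↦ (Real.pi : ℂ) ^ 2 / (Complex.sin (Real.pi * ((x : ℂ) + t * Complex.I))) ^ 2) (𝓝[>] 0)
      (𝓝 (Real.pi ^ 2 / (Complex.sin (Real.pi * x)) ^ 2)) := by
    have : ContinuousAt (fun t : ℝ ↦ (Real.pi : ℂ) ^ 2 / (Complex.sin (Real.pi * ((x : ℂ) + t * Complex.I))) ^ 2) 0 := by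
      refine ContinuousAt.div (by fun_prop) (by fun_prop) ?_
      simpa using hs
    have := this.tendsto
    simp only [Complex.ofReal_zero, zero_mul, add_zero] at this
    exact this.mono_left nhdsWithin_le_nhds
  refine tendsto_nhds_unique t1 (t2.congr' ?_)
  filter_upwards [self_mem_nhdsWithin] with t ht
  exact (hz_deriv _ (by simpa using ht)).symm

lemma chi_val (N : ℕ) (χ : DirichletCharacter ℂ N) (n : ℤ)
    (hn : IsUnit ((n : ℤ) : ZMod (2 * N))) :
    (DirichletCharacter.changeLevel (dvd_mul_left N 2) χ) ((n : ℤ) : ZMod (2 * N)) = χ (n : ZMod N) := by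
  have := DirichletCharacter.changeLevel_eq_cast_of_dvd χ (dvd_mul_left N 2) hn.unit
  rw [IsUnit.unit_spec, ZMod.cast_intCast (dvd_mul_left N 2)] at this
  exact this

lemma unit_iff (N : ℕ) (n : ℤ) :
    IsUnit ((n : ℤ) : ZMod (2 * N)) ↔ Odd n ∧ IsUnit (n : ZMod N) := by
  rw [ZMod.coe_int_isUnit_iff_isCoprime, ZMod.coe_int_isUnit_iff_isCoprime]
  push_cast
  rw [IsCoprime.mul_left_iff, Int.isCoprime_two_left]

lemma summ_f (M : ℕ) (ψ : DirichletCharacter ℂ M) :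
    Summable (fun n : ℤ ↦ ψ (n : ZMod M) / (n : ℂ) ^ 2) := by
  have := (EisensteinSeries.linear_right_summable 0 1 (k := 2) (by norm_num)).norm
  refine Summable.of_norm_bounded this fun n ↦ ?_
  rw [norm_div, div_eq_mul_inv]
  have h := DirichletCharacter.norm_le_one ψ (n : ZMod M)
  simp only [mul_zero, zero_add, norm_inv]
  calc _ ≤ 1 * (‖(n : ℂ) ^ 2‖)⁻¹ := by gcongr
    _ = _ := by rw [one_mul]; norm_cast

lemma sum_int (M : ℕ) (ψ : DirichletCharacter ℂ M) (hψ : ψ (-1) = 1) :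
    ∑' n : ℤ, ψ (n : ZMod M) / (n : ℂ) ^ 2 = 2 * ∑' n : ℕ, ψ (n : ZMod M) / (n : ℂ) ^ 2 := by
  rw [tsum_int_eq_zero_add_two_mul_tsum_pnat _ (summ_f M ψ)]
  · have h := tsum_pnat_eq_tsum_succ (f := fun n : ℕ ↦ ψ (n : ZMod M) / (n : ℂ) ^ 2)
    have h1 : Summable (fun n : ℕ ↦ ψ (n : ZMod M) / (n : ℂ) ^ 2) := by
      have := (summ_f M ψ).comp_injective (Nat.cast_injective (R := ℤ))
      refine this.congr fun n ↦ ?_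
      simp
    rw [h1.tsum_eq_zero_add, ← h]
    simp
  · intro n
    have : ψ (-(n : ZMod M)) = ψ (n : ZMod M) := by
      rw [neg_eq_neg_one_mul, map_mul, hψ, one_mul]
    simp [this]

lemma term_eq (N : ℕ) (hN0 : N ≠ 0) (m : ℤ) (hm : Odd m) :
    (1 : ℂ) / ((1 : ℂ) - (Real.cos (Real.pi * (m : ℝ) / N) : ℂ)) =
      2 * (N : ℂ) ^ 2 / (Real.pi : ℂ) ^ 2 * ∑' k : ℤ, 1 / ((m : ℂ) + 2 * N * k) ^ 2 := by
  have hNr : (N : ℝ) ≠ 0 := by exact_mod_cast hN0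
  have hNc : (N : ℂ) ≠ 0 := by exact_mod_cast hN0
  have hpi : (Real.pi : ℂ) ≠ 0 := by exact_mod_cast Real.pi_ne_zero
  have hs : Real.sin (Real.pi * ((m : ℝ) / (2 * N))) ≠ 0 := by
    rw [Real.sin_ne_zero_iff]
    intro n hn
    have h1 : (n : ℝ) * (2 * N) = m := by
      have h2 : (n : ℝ) = (m : ℝ) / (2 * N) := by
        apply mul_left_cancel₀ Real.pi_ne_zero
        linarith
      rw [h2]; field_simp
    have h3 : n * (2 * N) = m := by exact_mod_cast h1
    obtain ⟨q, hq⟩ := hm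
    have : (2 : ℤ) * (n * N) = 2 * q + 1 := by rw [← hq, ← h3]; ring
    omega
  have key := real_sum _ hs
  have hc : Real.cos (Real.pi * (m : ℝ) / N) = 1 - 2 * Real.sin (Real.pi * ((m : ℝ) / (2 * N))) ^ 2 := by
    rw [show Real.pi * (m : ℝ) / N = 2 * (Real.pi * ((m : ℝ) / (2 * N))) by field_simp, Real.cos_two_mul]
    linarith [Real.sin_sq_add_cos_sq (Real.pi * ((m : ℝ) / (2 * N)))]
  have e : ∀ k : ℤ, 1 / ((m : ℂ) + 2 * N * k) ^ 2 =
      1 / (2 * N : ℂ) ^ 2 * (1 / ((((m : ℝ) / (2 * N) : ℝ) : ℂ) + k) ^ 2) := by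
    intro k
    rw [one_div_mul_one_div, ← mul_pow]
    congr 2
    push_cast
    field_simp
  simp_rw [e]
  rw [tsum_mul_left, key, hc]
  have hs' : Complex.sin (Real.pi * (((m : ℝ) / (2 * N) : ℝ) : ℂ)) ≠ 0 := by exact_mod_cast hs
  push_cast at hs' ⊢
  rw [sub_sub_cancel]
  field_simp

theorem stmt12 (N : ℕ) [NeZero N] (hN : Odd N)
    (χ : DirichletCharacter ℂ N) (hχ : χ (-1) = 1)
    -- `r w` is any odd integer representative `w⁰` of `w` modulo `N`.
    (r : ZMod N → ℤ) (hr : ∀ w : ZMod N, ((r w : ZMod N) = w ∧ Odd (r w))) :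
    (1 / 2 : ℂ) * ∑ μ : (ZMod N)ˣ,
        χ (μ : ZMod N) /
          ((1 : ℂ) - (Real.cos (Real.pi * (r (μ : ZMod N) : ℝ) / N) : ℂ))
    = (2 * (N : ℂ) ^ 2 / (Real.pi : ℂ) ^ 2) *
        ∑' n : ℕ, (DirichletCharacter.changeLevel (dvd_mul_left N 2) χ)
          ((n : ℕ) : ZMod (2 * N)) / (n : ℂ) ^ 2 := by
  have hN0 : N ≠ 0 := NeZero.ne N
  set ψ := DirichletCharacter.changeLevel (dvd_mul_left N 2) χ with hψdef
  have hψ : ψ (-1) = 1 := by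
    have := chi_val N χ (-1) (by simp)
    push_cast at this
    rw [hψdef, this, hχ]
  let φ : (ZMod N)ˣ × ℤ → ℤ := fun p ↦ r (p.1 : ZMod N) + 2 * N * p.2
  have hφ (p : (ZMod N)ˣ × ℤ) : ((φ p : ℤ) : ZMod N) = p.1 := by
    simp [φ, (hr _).1]
  have hodd (p : (ZMod N)ˣ × ℤ) : Odd (φ p) := by
    have := (hr (p.1 : ZMod N)).2
    simp only [φ]
    rw [mul_assoc]
    exact this.add_even (even_two_mul _)
  have hinj : Function.Injective φ := by
    intro p q h
    have h1 : p.1 = q.1 := by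
      apply Units.ext
      rw [← hφ p, ← hφ q, h]
    refine Prod.ext h1 ?_
    simp only [φ, h1] at h
    have : (2 * N : ℤ) ≠ 0 := by positivity
    exact mul_left_cancel₀ this (by linarith)
  have hψφ (p : (ZMod N)ˣ × ℤ) : ψ ((φ p : ℤ) : ZMod (2 * N)) = χ (p.1 : ZMod N) := by
    have hu : IsUnit ((φ p : ℤ) : ZMod (2 * N)) :=
      (unit_iff N _).2 ⟨hodd p, by rw [hφ]; exact p.1.isUnit⟩
    rw [hψdef, chi_val N χ _ hu, hφ]
  have hsupp : Function.support (fun n : ℤ ↦ ψ (n : ZMod (2 * N)) / (n : ℂ) ^ 2) ⊆ Set.range φ := by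
    intro n hn
    have hu : IsUnit (n : ZMod (2 * N)) := by
      by_contra h
      exact hn (by simp [MulChar.map_nonunit ψ h])
    obtain ⟨ho, hu'⟩ := (unit_iff N n).1 hu
    obtain ⟨h1, h2⟩ := hr (n : ZMod N)
    have d1 : (N : ℤ) ∣ n - r (n : ZMod N) := by
      rw [← ZMod.intCast_eq_intCast_iff_dvd_sub]; exact h1
    have d2 : (2 : ℤ) ∣ n - r (n : ZMod N) := (ho.sub_odd h2).two_dvd
    have hc : IsCoprime (2 : ℤ) N := Int.isCoprime_two_left.2 (by exact_mod_cast hN)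
    obtain ⟨k, hk⟩ := hc.mul_dvd d2 d1
    refine ⟨(hu'.unit, k), ?_⟩
    simp only [φ, IsUnit.unit_spec]
    linarith
  have hsum := (summ_f _ ψ).comp_injective hinj
  have h1 := hinj.tsum_eq hsupp
  rw [sum_int _ ψ hψ] at h1
  have h2 := hsum.tsum_prod
  simp only [Function.comp_def] at h2
  rw [h2, tsum_fintype] at h1
  have h3 : ∑ μ : (ZMod N)ˣ, χ (μ : ZMod N) /
          ((1 : ℂ) - (Real.cos (Real.pi * (r (μ : ZMod N) : ℝ) / N) : ℂ)) =
      2 * (N : ℂ) ^ 2 / (Real.pi : ℂ) ^ 2 *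
        ∑ μ : (ZMod N)ˣ, ∑' k : ℤ, ψ ((φ (μ, k) : ℤ) : ZMod (2 * N)) / ((φ (μ, k) : ℤ) : ℂ) ^ 2 := by
    rw [Finset.mul_sum]
    refine Finset.sum_congr rfl fun μ _ ↦ ?_
    rw [div_eq_mul_one_div, term_eq N hN0 _ (hr _).2]
    simp_rw [hψφ, div_eq_mul_one_div (χ _)]
    rw [tsum_mul_left]
    simp only [φ]
    push_cast
    ring
  rw [h3, h1]
  ring
end

section
/- Let N be an odd positive integer and let χ be an even Dirichlet character modulo N (χ(−1) = 1). Then the finite sum ∑_{μ ∈ (ℤ/Nℤ)ˣ} χ(μ)/(1 − cos(πμ⁰/N)) is nonzero, where for each μ, μ⁰ ∈ ℤ is any odd integer representative of μ modulo N. -/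
open Complex Filter Topology
open scoped Real
lemma cot_upper (z : ℂ) (hz : 0 < z.im) :
    ∑' n : ℤ, 1 / (z + n) ^ 2 = π ^ 2 / Complex.sin (π * z) ^ 2 := by
  have hz' : z ∈ UpperHalfPlane.upperHalfPlaneSet := hz
  have h := iteratedDerivWithin_cot_pi_mul_eq_mul_tsum_div_pow (k := 1) le_rfl hz'
  have hs : Complex.sin (π * z) ≠ 0 :=
    sin_pi_mul_ne_zero (UpperHalfPlane.coe_mem_integerComplement ⟨z, hz⟩)
  have hd : HasDerivAt (fun x : ℂ ↦ π * Complex.cot (π * x)) (-(π ^ 2 / Complex.sin (π * z) ^ 2)) z := by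
    have h1 : HasDerivAt (fun x : ℂ ↦ (π : ℂ) * x) π z := by
      simpa using (hasDerivAt_id z).const_mul (π : ℂ)
    have h2 := ((h1.ccos).div h1.csin hs).const_mul (π : ℂ)
    refine h2.congr_deriv ?_
    have h3 := Complex.sin_sq_add_cos_sq (π * z)
    field_simp
    linear_combination (-1 : ℂ) * h3
  rw [iteratedDerivWithin_one, hd.hasDerivWithinAt.derivWithin
    (UpperHalfPlane.isOpen_upperHalfPlaneSet.uniqueDiffWithinAt hz')] at h
  simp at h
  simpa using h.symm

lemma sum_sq (x : ℝ) (hx : ∀ n : ℤ, x + n ≠ 0) (hs : Complex.sin (π * x) ≠ 0) :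
    ∑' n : ℤ, 1 / ((x : ℂ) + n) ^ 2 = π ^ 2 / Complex.sin (π * x) ^ 2 := by
  have hc : Continuous fun y : ℝ => (x : ℂ) + y * I := by fun_prop
  have h1 : Tendsto (fun y : ℝ => ∑' n : ℤ, 1 / (((x : ℂ) + y * I) + n) ^ 2) (𝓝[>] 0)
      (𝓝 (∑' n : ℤ, 1 / ((x : ℂ) + n) ^ 2)) := by
    refine tendsto_tsum_of_dominated_convergence (bound := fun n : ℤ => ‖1 / ((x : ℂ) + n) ^ 2‖)
      ?_ ?_ ?_
    · have := EisensteinSeries.linear_right_summable x 1 (k := 2) (by norm_num)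
      refine Summable.norm ?_
      refine this.congr fun n => ?_
      simp
    · intro n
      have hn : (x : ℂ) + n ≠ 0 := by exact_mod_cast hx n
      have : ContinuousAt (fun y : ℝ => 1 / (((x : ℂ) + y * I) + n) ^ 2) 0 := by
        refine ContinuousAt.div (by fun_prop) (by fun_prop) ?_
        simpa using hn
      have := this.tendsto.mono_left (nhdsWithin_le_nhds (s := Set.Ioi 0))
      simpa using this
    · refine Eventually.of_forall fun y n => ?_
      have hn : (x : ℂ) + n ≠ 0 := by exact_mod_cast hx n
      rw [norm_div, norm_div, norm_pow, norm_pow]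
      have : ‖(x : ℂ) + n‖ ≤ ‖(x : ℂ) + y * I + n‖ := by
        have h := Complex.abs_re_le_norm ((x : ℂ) + y * I + n)
        simp at h
        rw [show (x : ℂ) + n = ((x + n : ℝ) : ℂ) by push_cast; rfl, Complex.norm_real]
        simpa using h
      have : 0 < ‖(x : ℂ) + n‖ := norm_pos_iff.2 hn
      gcongr
  have h2 : Tendsto (fun y : ℝ => (π : ℂ) ^ 2 / Complex.sin (π * ((x : ℂ) + y * I)) ^ 2) (𝓝[>] 0)
      (𝓝 (π ^ 2 / Complex.sin (π * x) ^ 2)) := by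
    have : ContinuousAt (fun y : ℝ => (π : ℂ) ^ 2 / Complex.sin (π * ((x : ℂ) + y * I)) ^ 2) 0 := by
      refine ContinuousAt.div (by fun_prop) (by fun_prop) ?_
      simpa using hs
    have := this.tendsto.mono_left (nhdsWithin_le_nhds (s := Set.Ioi 0))
    simpa using this
  refine tendsto_nhds_unique h1 (h2.congr' ?_)
  filter_upwards [self_mem_nhdsWithin] with y hy
  rw [cot_upper]
  simpa using hy

lemma odd_term (N : ℕ) [NeZero N] (r : ℤ) (hr : Odd r) :
    1 / ((1 : ℂ) - (Real.cos (π * (r : ℝ) / N) : ℂ)) =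
      (2 * N ^ 2 / π ^ 2) * ∑' n : ℤ, 1 / ((r + 2 * N * n : ℤ) : ℂ) ^ 2 := by
  have hN : (N : ℝ) ≠ 0 := by exact_mod_cast NeZero.ne N
  have hN' : (N : ℂ) ≠ 0 := by exact_mod_cast NeZero.ne N
  have hp : (π : ℂ) ≠ 0 := by exact_mod_cast Real.pi_ne_zero
  have hx : ∀ n : ℤ, (r / (2 * N) : ℝ) + n ≠ 0 := by
    intro n h
    field_simp at h
    have h' : r + 2 * N * n = 0 := by exact_mod_cast h
    obtain ⟨k, rfl⟩ := hr
    have : 2 * (k + N * n) = -1 := by linarith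
    omega
  have hsr : Real.sin (π * (r / (2 * N))) ≠ 0 := by
    rw [Real.sin_ne_zero_iff]
    intro n h
    rw [mul_comm] at h
    have := mul_left_cancel₀ Real.pi_ne_zero h
    apply hx (-n)
    rw [← this]; simp
  have hs : Complex.sin (π * ((r / (2 * N) : ℝ) : ℂ)) ≠ 0 := by exact_mod_cast hsr
  have h := sum_sq _ hx hs
  have e : ∀ n : ℤ, 1 / (((r / (2 * N) : ℝ) : ℂ) + n) ^ 2 =
      (4 * N ^ 2) * (1 / ((r + 2 * N * n : ℤ) : ℂ) ^ 2) := by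
    intro n
    have : ((r / (2 * N) : ℝ) : ℂ) + n = ((r + 2 * N * n : ℤ) : ℂ) / (2 * N) := by
      push_cast; field_simp
    rw [this, div_pow, one_div_div]; ring
  simp_rw [e] at h
  rw [tsum_mul_left] at h
  have hc : Real.cos (π * (r : ℝ) / N) = 1 - 2 * Real.sin (π * (r / (2 * N))) ^ 2 := by
    have h1 := Real.cos_two_mul (π * (r / (2 * N)))
    have h2 := Real.sin_sq_add_cos_sq (π * (r / (2 * N)))
    rw [show π * (r : ℝ) / N = 2 * (π * (r / (2 * N))) by field_simp, h1]
    linarith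
  have hc' : (Real.cos (π * (r : ℝ) / N) : ℂ) =
      1 - 2 * Complex.sin (π * ((r / (2 * N) : ℝ) : ℂ)) ^ 2 := by
    rw [hc]; push_cast; rfl
  rw [hc']
  generalize Complex.sin (π * ((r / (2 * N) : ℝ) : ℂ)) = S at *
  generalize (∑' n : ℤ, 1 / ((r + 2 * N * n : ℤ) : ℂ) ^ 2) = T at *
  rw [eq_div_iff (pow_ne_zero 2 hs)] at h
  rw [sub_sub_cancel]
  field_simp
  linear_combination -h

lemma chi2_odd (N : ℕ) (χ : DirichletCharacter ℂ N) (m : ℤ) (hm : Odd m) :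
    DirichletCharacter.changeLevel (Dvd.intro_left 2 rfl : N ∣ 2 * N) χ (m : ZMod (2 * N)) =
      χ (m : ZMod N) := by
  have h2 : IsCoprime m 2 := by
    obtain ⟨k, rfl⟩ := hm
    exact ⟨1, -k, by ring⟩
  by_cases h : IsCoprime m (N : ℤ)
  · refine DirichletCharacter.changeLevel_eq_cast_of_dvd' χ _ ?_
    push_cast
    exact h2.mul_right h
  · have h' : ¬ IsCoprime m ((2 * N : ℕ) : ℤ) := by
      intro h3
      push_cast at h3
      exact h (IsCoprime.of_mul_right_right h3)
    rw [MulChar.map_nonunit, MulChar.map_nonunit]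
    · rwa [ZMod.coe_int_isUnit_iff_isCoprime, isCoprime_comm]
    · rwa [ZMod.coe_int_isUnit_iff_isCoprime, isCoprime_comm]

lemma chi2_even (N : ℕ) (χ : DirichletCharacter ℂ (2 * N)) (m : ℤ) (hm : ¬ Odd m) :
    χ (m : ZMod (2 * N)) = 0 := by
  rw [MulChar.map_nonunit]
  rw [ZMod.coe_int_isUnit_iff_isCoprime]
  intro h
  push_cast at h
  have h2 : IsCoprime (2 : ℤ) m := IsCoprime.of_mul_left_left h
  obtain ⟨k, hk⟩ := Int.not_odd_iff_even.1 hm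
  obtain ⟨a, b, hab⟩ := h2
  rw [hk] at hab
  have : 2 * (a + b * k) = 1 := by linarith
  omega

lemma summ (M : ℕ) (χ : DirichletCharacter ℂ M) :
    Summable fun m : ℤ => χ (m : ZMod M) * (1 / (m : ℂ) ^ 2) := by
  have h : Summable fun m : ℤ => 1 / (m : ℝ) ^ 2 := Real.summable_one_div_int_pow.2 (by norm_num)
  refine Summable.of_norm_bounded h fun m => ?_
  rw [norm_mul, norm_div, norm_pow, norm_one, Complex.norm_intCast, sq_abs]
  exact mul_le_of_le_one_left (by positivity) (χ.norm_le_one _)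

lemma tsum_int_ne (M : ℕ) (χ : DirichletCharacter ℂ M) (hχ : χ (-1) = 1) :
    ∑' m : ℤ, χ (m : ZMod M) * (1 / (m : ℂ) ^ 2) ≠ 0 := by
  rw [tsum_int_eq_zero_add_two_mul_tsum_pnat _ (summ M χ)]
  · have h := DirichletCharacter.LSeries_ne_zero_of_one_lt_re χ (s := 2) (by norm_num)
    rw [LSeries, ← tsum_pnat_eq_tsum_of_eq_zero (LSeries.term_zero _ _)] at h
    have e : ∀ n : ℕ+, LSeries.term (fun n : ℕ => χ (n : ZMod M)) 2 (n : ℕ) =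
        χ (((n : ℕ) : ℤ) : ZMod M) * (1 / (((n : ℕ) : ℤ) : ℂ) ^ 2) := by
      intro n
      rw [LSeries.term_of_ne_zero n.ne_zero]
      simp [div_eq_mul_inv]
    simp_rw [e] at h
    simpa using h
  · intro m
    have : χ (-(m : ZMod M)) = χ (m : ZMod M) := by
      rw [← neg_one_mul, map_mul, hχ, one_mul]
    push_cast
    rw [this]; simp

theorem stmt13 (N : ℕ) [NeZero N] (hN : Odd N)
    (χ : DirichletCharacter ℂ N) (hχ : χ (-1) = 1)
    -- `r w` is any odd integer representative `w⁰` of `w` modulo `N`.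
    (r : ZMod N → ℤ) (hr : ∀ w : ZMod N, ((r w : ZMod N) = w ∧ Odd (r w))) :
    (∑ μ : (ZMod N)ˣ,
        χ (μ : ZMod N) /
          ((1 : ℂ) - (Real.cos (Real.pi * (r (μ : ZMod N) : ℝ) / N) : ℂ))) ≠ 0 := by
  have hN0 : (N : ℤ) ≠ 0 := by exact_mod_cast NeZero.ne N
  -- pass to all residues
  have h1 : (∑ μ : (ZMod N)ˣ, χ (μ : ZMod N) /
          ((1 : ℂ) - (Real.cos (Real.pi * (r (μ : ZMod N) : ℝ) / N) : ℂ))) =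
      ∑ w : ZMod N, χ w / ((1 : ℂ) - (Real.cos (Real.pi * (r w : ℝ) / N) : ℂ)) := by
    refine Finset.sum_of_injOn (fun u : (ZMod N)ˣ => (u : ZMod N))
      (fun a _ b _ h => Units.ext h) (by simp) ?_ (by simp)
    intro w _ hw
    rw [MulChar.map_nonunit, zero_div]
    rintro ⟨u, rfl⟩
    exact hw ⟨u, by simp, rfl⟩
  rw [h1]
  set χ₂ := DirichletCharacter.changeLevel (Dvd.intro_left 2 rfl : N ∣ 2 * N) χ with hχ₂
  have hχ₂1 : χ₂ (-1) = 1 := by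
    have := chi2_odd N χ (-1) (by decide)
    push_cast at this
    rw [hχ₂, this, hχ]
  have hne := tsum_int_ne _ χ₂ hχ₂1
  have hsum := summ _ χ₂
  set F : ℤ → ℂ := fun m => χ₂ (m : ZMod (2 * N)) * (1 / (m : ℂ) ^ 2) with hF
  let g : ZMod N × ℤ → ℤ := fun p => r p.1 + 2 * N * p.2
  have hgc : ∀ p, ((g p : ℤ) : ZMod N) = p.1 := by
    intro p; simp [g, (hr p.1).1]
  have hgo : ∀ p, Odd (g p) := by
    intro p
    refine (hr p.1).2.add_even ⟨N * p.2, by ring⟩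
  have hgi : Function.Injective g := by
    rintro ⟨a, m⟩ ⟨b, n⟩ h
    have hab : a = b := by
      have := congrArg (fun z : ℤ => (z : ZMod N)) h
      simpa [hgc] using this
    subst hab
    have h5 : m = n := by simpa [g, NeZero.ne N] using h
    rw [h5]
  have hgs : Function.support F ⊆ Set.range g := by
    intro m hm
    have hmo : Odd m := by
      by_contra h
      exact hm (by simp [hF, chi2_even N χ₂ m h])
    have h3 : (N : ℤ) ∣ m - r (m : ZMod N) := by
      rw [← ZMod.intCast_zmod_eq_zero_iff_dvd]
      simp [(hr (m : ZMod N)).1]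
    have h2 : (2 : ℤ) ∣ m - r (m : ZMod N) := (hmo.sub_odd (hr _).2).two_dvd
    have hcop : IsCoprime (2 : ℤ) N := by
      obtain ⟨k, hk⟩ := hN
      exact ⟨-k, 1, by rw [hk]; push_cast; ring⟩
    obtain ⟨n, hn⟩ := hcop.mul_dvd h2 h3
    exact ⟨((m : ZMod N), n), by simp only [g]; linarith⟩
  have h4 : ∑' p, F (g p) = ∑' m, F m := hgi.tsum_eq hgs
  have hsg : Summable fun p => F (g p) := hsum.comp_injective hgi
  rw [← h4, hsg.tsum_prod, tsum_fintype] at hne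
  intro h0
  apply hne
  have hp : (π : ℂ) ≠ 0 := by exact_mod_cast Real.pi_ne_zero
  have hN' : (N : ℂ) ≠ 0 := by exact_mod_cast NeZero.ne N
  have hcst : (2 * N ^ 2 / π ^ 2 : ℂ) ≠ 0 :=
    div_ne_zero (mul_ne_zero two_ne_zero (pow_ne_zero 2 hN')) (pow_ne_zero 2 hp)
  refine (mul_eq_zero.1 ?_).resolve_left hcst
  rw [← h0, Finset.mul_sum]
  refine Finset.sum_congr rfl fun w _ => ?_
  rw [div_eq_mul_one_div (χ w), odd_term N _ (hr w).2]
  have : ∀ n, F (g (w, n)) = χ w * (1 / ((r w + 2 * N * n : ℤ) : ℂ) ^ 2) := by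
    intro n
    simp only [hF]
    rw [hχ₂, chi2_odd N χ _ (hgo _), hgc]
  simp only [this]
  rw [tsum_mul_left]
  ring
end
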